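/- For all integers ℓ ≥ 1, q ≥ 2 and i ≥ 1, one has |G_ℓ(i)| < |G_ℓ(i−1)| and |H_ℓ(i)| < |H_ℓ(i−1)|; that is, the sequences of absolute values |G_ℓ(i)| and |H_ℓ(i)| are strictly decreasing in i. -/

import Mathlib

/-- `r(x) = qx^{2ℓ+1} − x^{4ℓ} + x^{5ℓ} − qx^{5ℓ+1} + x^{6ℓ}`. -/
noncomputable def rPoly (q ℓ : ℕ) (x : ℝ) : ℝ :=
  q * x ^ (2 * (ℓ : ℤ) + 1) - x ^ (4 * (ℓ : ℤ)) + x ^ (5 * (ℓ : ℤ)) -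
    q * x ^ (5 * (ℓ : ℤ) + 1) + x ^ (6 * (ℓ : ℤ))

/-- `s(x) = 1 − qx^{1−ℓ} + x^{−ℓ}`. -/
noncomputable def sPoly (q ℓ : ℕ) (x : ℝ) : ℝ :=
  1 - q * x ^ (1 - (ℓ : ℤ)) + x ^ (-(ℓ : ℤ))

/-- `u(x) = qx^{4ℓ+1} − x^{5ℓ} + qx^{5ℓ+1} − x^{6ℓ}`. -/
noncomputable def uPoly (q ℓ : ℕ) (x : ℝ) : ℝ :=
  q * x ^ (4 * (ℓ : ℤ) + 1) - x ^ (5 * (ℓ : ℤ)) + q * x ^ (5 * (ℓ : ℤ) + 1) -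
    x ^ (6 * (ℓ : ℤ))

/-- `v(x) = 1 − qx^{1−ℓ} + x^{−ℓ} − qx^{1−2ℓ} + x^{−2ℓ}`. -/
noncomputable def vPoly (q ℓ : ℕ) (x : ℝ) : ℝ :=
  1 - q * x ^ (1 - (ℓ : ℤ)) + x ^ (-(ℓ : ℤ)) - q * x ^ (1 - 2 * (ℓ : ℤ)) +
    x ^ (-(2 * (ℓ : ℤ)))

/-- `G_ℓ(i) = (−1)^i r(q^{−2^{i+1}}) ∏_{j=0}^{i−1} s(q^{−2^{j+1}})
  / ∏_{k=0}^{i} (1 − q^{1−2^{k+1}})`. -/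
noncomputable def Gterm (q ℓ i : ℕ) : ℝ :=
  (-1 : ℝ) ^ i * rPoly q ℓ ((q : ℝ) ^ (-(2 : ℤ) ^ (i + 1))) *
      (∏ j ∈ Finset.range i, sPoly q ℓ ((q : ℝ) ^ (-(2 : ℤ) ^ (j + 1)))) /
    ∏ k ∈ Finset.range (i + 1), (1 - (q : ℝ) ^ ((1 : ℤ) - 2 ^ (k + 1)))

/-- `H_ℓ(i) = (−1)^i u(q^{−2^{i+1}}) ∏_{j=0}^{i−1} v(q^{−2^{j+1}})
  / ∏_{k=0}^{i} (1 − q^{1−2^{k+1}})`. -/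
noncomputable def Hterm (q ℓ i : ℕ) : ℝ :=
  (-1 : ℝ) ^ i * uPoly q ℓ ((q : ℝ) ^ (-(2 : ℤ) ^ (i + 1))) *
      (∏ j ∈ Finset.range i, vPoly q ℓ ((q : ℝ) ^ (-(2 : ℤ) ^ (j + 1)))) /
    ∏ k ∈ Finset.range (i + 1), (1 - (q : ℝ) ^ ((1 : ℤ) - 2 ^ (k + 1)))

theorem rPoly_eq (q ℓ : ℕ) {x : ℝ} (hx : 0 < x) :
    rPoly q ℓ x = (x ^ ℓ) ^ 2 * (q * x - (x ^ ℓ) ^ 2 + (x ^ ℓ) ^ 3 - q * x * (x ^ ℓ) ^ 3 +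
      (x ^ ℓ) ^ 4) := by
  have h (n : ℕ) : x ^ ((n : ℤ) * (ℓ : ℤ)) = (x ^ ℓ) ^ n := by
    rw [mul_comm, zpow_mul, zpow_natCast, zpow_natCast]
  have h2 := h 2
  have h4 := h 4
  have h5 := h 5
  have h6 := h 6
  push_cast at h2 h4 h5 h6
  rw [rPoly, zpow_add_one₀ hx.ne', zpow_add_one₀ hx.ne', h2, h4, h5, h6]
  ring

theorem uPoly_eq (q ℓ : ℕ) {x : ℝ} (hx : 0 < x) :
    uPoly q ℓ x = (x ^ ℓ) ^ 4 * ((q * x - x ^ ℓ) * (1 + x ^ ℓ)) := by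
  have h (n : ℕ) : x ^ ((n : ℤ) * (ℓ : ℤ)) = (x ^ ℓ) ^ n := by
    rw [mul_comm, zpow_mul, zpow_natCast, zpow_natCast]
  have h4 := h 4
  have h5 := h 5
  have h6 := h 6
  push_cast at h4 h5 h6
  rw [uPoly, zpow_add_one₀ hx.ne', zpow_add_one₀ hx.ne', h4, h5, h6]
  ring

theorem sPoly_eq (q ℓ : ℕ) {x : ℝ} (hx : 0 < x) :
    sPoly q ℓ x = (1 - q * x + x ^ ℓ) / x ^ ℓ := by
  have ha : x ^ ℓ ≠ 0 := (pow_pos hx ℓ).ne'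
  rw [sPoly, zpow_sub₀ hx.ne', zpow_neg, zpow_one, zpow_natCast]
  field_simp
  ring

theorem vPoly_eq (q ℓ : ℕ) {x : ℝ} (hx : 0 < x) :
    vPoly q ℓ x = ((x ^ ℓ) ^ 2 + (1 - q * x) * (1 + x ^ ℓ)) / (x ^ ℓ) ^ 2 := by
  have ha : x ^ ℓ ≠ 0 := (pow_pos hx ℓ).ne'
  have h2 : x ^ (2 * (ℓ : ℤ)) = (x ^ ℓ) ^ 2 := by
    rw [mul_comm, zpow_mul, zpow_natCast]; rfl
  rw [vPoly, zpow_sub₀ hx.ne', zpow_sub₀ hx.ne', zpow_neg, zpow_neg, zpow_one, zpow_natCast, h2]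
  field_simp
  ring

theorem pow_le_half_mul {q ℓ : ℕ} (hq : 2 ≤ q) (hℓ : 1 ≤ ℓ) {x : ℝ} (hx : 0 < x)
    (hqx : (q : ℝ) ^ 2 * x ≤ 1) :
    x ≤ 1 / 4 ∧ x ^ ℓ ≤ x ∧ 2 * x ≤ q * x ∧ q * x ≤ 1 / 2 := by
  have hq' : (2 : ℝ) ≤ q := by exact_mod_cast hq
  have h2 : 2 * x ≤ q * x := by gcongr
  have h3 : 2 * (q * x) ≤ q ^ 2 * x := by
    rw [sq, mul_assoc]; gcongr
  have hx4 : x ≤ 1 / 4 := by linarith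
  exact ⟨hx4, pow_le_of_le_one hx.le (by linarith) (by omega), h2, by linarith⟩

theorem rPoly_factor_lower {a t : ℝ} (ha : 0 < a) (ha4 : a ≤ 1 / 4) (hat : 2 * a ≤ t) :
    6 / 7 * t ≤ t - a ^ 2 + a ^ 3 - t * a ^ 3 + a ^ 4 := by
  have h2 : a ^ 2 ≤ t / 8 := by nlinarith
  have h3 : a ^ 3 ≤ 1 / 64 := by
    calc a ^ 3 ≤ (1 / 4) ^ 3 := by gcongr
      _ = 1 / 64 := by norm_num
  have h4 : t * a ^ 3 ≤ t * (1 / 64) := by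
    have : 0 ≤ t := by linarith
    gcongr
  have : 0 < a ^ 3 := by positivity
  have : 0 < a ^ 4 := by positivity
  linarith

theorem rPoly_pos {q ℓ : ℕ} (hq : 2 ≤ q) (hℓ : 1 ≤ ℓ) {x : ℝ} (hx : 0 < x)
    (hqx : (q : ℝ) ^ 2 * x ≤ 1) : 0 < rPoly q ℓ x := by
  obtain ⟨h4, hl, h2, -⟩ := pow_le_half_mul hq hℓ hx hqx
  have ha : 0 < x ^ ℓ := pow_pos hx ℓ
  have := rPoly_factor_lower ha (hl.trans h4) (t := q * x) (by linarith)
  rw [rPoly_eq q ℓ hx]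
  exact mul_pos (by positivity) (by linarith)

theorem uPoly_pos {q ℓ : ℕ} (hq : 2 ≤ q) (hℓ : 1 ≤ ℓ) {x : ℝ} (hx : 0 < x)
    (hqx : (q : ℝ) ^ 2 * x ≤ 1) : 0 < uPoly q ℓ x := by
  obtain ⟨-, hl, h2, -⟩ := pow_le_half_mul hq hℓ hx hqx
  have ha : 0 < x ^ ℓ := pow_pos hx ℓ
  rw [uPoly_eq q ℓ hx]
  exact mul_pos (by positivity) (mul_pos (by linarith) (by linarith))

theorem sPoly_pos {q ℓ : ℕ} (hq : 2 ≤ q) (hℓ : 1 ≤ ℓ) {x : ℝ} (hx : 0 < x)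
    (hqx : (q : ℝ) ^ 2 * x ≤ 1) : 0 < sPoly q ℓ x := by
  obtain ⟨-, -, -, h⟩ := pow_le_half_mul hq hℓ hx hqx
  have ha : 0 < x ^ ℓ := pow_pos hx ℓ
  rw [sPoly_eq q ℓ hx]
  exact div_pos (by linarith) ha

theorem vPoly_pos {q ℓ : ℕ} (hq : 2 ≤ q) (hℓ : 1 ≤ ℓ) {x : ℝ} (hx : 0 < x)
    (hqx : (q : ℝ) ^ 2 * x ≤ 1) : 0 < vPoly q ℓ x := by
  obtain ⟨-, -, -, h⟩ := pow_le_half_mul hq hℓ hx hqx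
  have ha : 0 < x ^ ℓ := pow_pos hx ℓ
  rw [vPoly_eq q ℓ hx]
  have : 0 < (1 - q * x) * (1 + x ^ ℓ) := mul_pos (by linarith) (by linarith)
  positivity

theorem rPoly_sq_mul_sPoly_lt {q ℓ : ℕ} (hq : 2 ≤ q) (hℓ : 1 ≤ ℓ) {x : ℝ} (hx : 0 < x)
    (hqx : (q : ℝ) ^ 2 * x ≤ 1) :
    rPoly q ℓ (x ^ 2) * sPoly q ℓ x < rPoly q ℓ x * (1 - q * x ^ 2) := by
  obtain ⟨h4, hl, h2, ht⟩ := pow_le_half_mul hq hℓ hx hqx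
  have ha : 0 < x ^ ℓ := pow_pos hx ℓ
  rw [rPoly_eq q ℓ hx, rPoly_eq q ℓ (pow_pos hx 2), sPoly_eq q ℓ hx, ← pow_mul x 2 ℓ,
    mul_comm 2 ℓ, pow_mul x ℓ 2, show (q : ℝ) * x ^ 2 = q * x * x by ring]
  generalize x ^ ℓ = a at *
  generalize (q : ℝ) * x = t at *
  have ht0 : 0 < t := by linarith
  have hlow := rPoly_factor_lower ha (hl.trans h4) (t := t) (by linarith)
  have htx : t * x ≤ t * (1 / 4) := by gcongr
  have hup : t * x - (a ^ 2) ^ 2 + (a ^ 2) ^ 3 - t * x * (a ^ 2) ^ 3 + (a ^ 2) ^ 4 ≤ t / 4 := by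
    have h1 : a ^ 2 ≤ 1 / 16 := by nlinarith
    have h2 : 0 < a ^ 2 := by positivity
    have h3 : 0 ≤ t * x * (a ^ 2) ^ 3 := by positivity
    have h5 : (a ^ 2) ^ 2 * (a ^ 2 + (a ^ 2) ^ 2 - 1) ≤ 0 :=
      mul_nonpos_of_nonneg_of_nonpos (by positivity) (by nlinarith)
    nlinarith
  have hcoef : a * (1 - t + a) ≤ 1 / 4 * (5 / 4) :=
    mul_le_mul (by linarith) (by linarith) (by linarith) (by norm_num)
  have hcoef0 : 0 ≤ a * (1 - t + a) := mul_nonneg ha.le (by linarith)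
  calc _ = a ^ 2 * (a * (1 - t + a) * (t * x - (a ^ 2) ^ 2 + (a ^ 2) ^ 3 -
          t * x * (a ^ 2) ^ 3 + (a ^ 2) ^ 4)) := by field_simp
    _ ≤ a ^ 2 * (1 / 4 * (5 / 4) * (t / 4)) := by
      refine mul_le_mul_of_nonneg_left ?_ (by positivity)
      exact (mul_le_mul_of_nonneg_left hup hcoef0).trans
        (mul_le_mul_of_nonneg_right hcoef (by positivity))
    _ < a ^ 2 * (6 / 7 * t * (7 / 8)) := by
      refine mul_lt_mul_of_pos_left ?_ (by positivity)
      linarith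
    _ ≤ _ := by
      rw [mul_assoc (a ^ 2)]
      refine mul_le_mul_of_nonneg_left ?_ (by positivity)
      exact mul_le_mul hlow (by linarith) (by norm_num) (by linarith)

theorem uPoly_sq_mul_vPoly_lt {q ℓ : ℕ} (hq : 2 ≤ q) (hℓ : 1 ≤ ℓ) {x : ℝ} (hx : 0 < x)
    (hqx : (q : ℝ) ^ 2 * x ≤ 1) :
    uPoly q ℓ (x ^ 2) * vPoly q ℓ x < uPoly q ℓ x * (1 - q * x ^ 2) := by
  obtain ⟨h4, hl, h2, ht⟩ := pow_le_half_mul hq hℓ hx hqx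
  have ha : 0 < x ^ ℓ := pow_pos hx ℓ
  rw [uPoly_eq q ℓ hx, uPoly_eq q ℓ (pow_pos hx 2), vPoly_eq q ℓ hx, ← pow_mul x 2 ℓ,
    mul_comm 2 ℓ, pow_mul x ℓ 2, show (q : ℝ) * x ^ 2 = q * x * x by ring]
  generalize x ^ ℓ = a at *
  generalize (q : ℝ) * x = t at *
  have ht0 : 0 < t := by linarith
  have htx : t * x ≤ t * (1 / 4) := by gcongr
  have ha2 : a ^ 2 ≤ 1 / 16 := by nlinarith
  have ha20 : 0 < a ^ 2 := by positivity
  have hv : a ^ 2 + (1 - t) * (1 + a) ≤ 2 := by nlinarith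
  have hv0 : 0 ≤ a ^ 2 + (1 - t) * (1 + a) :=
    add_nonneg ha20.le (mul_nonneg (by linarith) (by linarith))
  have hu : (t * x - a ^ 2) * (1 + a ^ 2) ≤ t / 4 * 2 :=
    mul_le_mul (by linarith) (by linarith) (by linarith) (by linarith)
  have hcoef : a ^ 2 * (a ^ 2 + (1 - t) * (1 + a)) ≤ 1 / 16 * 2 :=
    mul_le_mul ha2 hv hv0 (by norm_num)
  calc _ = a ^ 4 * (a ^ 2 * (a ^ 2 + (1 - t) * (1 + a)) *
          ((t * x - a ^ 2) * (1 + a ^ 2))) := by field_simp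
    _ ≤ a ^ 4 * (1 / 16 * 2 * (t / 4 * 2)) := by
      refine mul_le_mul_of_nonneg_left ?_ (by positivity)
      exact (mul_le_mul_of_nonneg_left hu (mul_nonneg ha20.le hv0)).trans
        (mul_le_mul_of_nonneg_right hcoef (by positivity))
    _ < a ^ 4 * (t / 2 * 1 * (7 / 8)) := by
      refine mul_lt_mul_of_pos_left ?_ (by positivity)
      linarith
    _ ≤ _ := by
      rw [mul_assoc (a ^ 4)]
      refine mul_le_mul_of_nonneg_left ?_ (by positivity)
      refine mul_le_mul ?_ (by linarith) (by norm_num)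
        (mul_nonneg (by linarith) (by linarith))
      exact mul_le_mul (by linarith) (by linarith) (by norm_num) (by linarith)

theorem abs_alternating_term_succ_lt {f g d : ℕ → ℝ} (hf : ∀ i, 0 < f i) (hg : ∀ i, 0 < g i)
    (hd : ∀ i, 0 < d i) {i : ℕ} (h : f (i + 1) * g i < f i * d (i + 1)) :
    |(-1 : ℝ) ^ (i + 1) * f (i + 1) * (∏ j ∈ Finset.range (i + 1), g j) /
        ∏ k ∈ Finset.range (i + 1 + 1), d k| <
      |(-1 : ℝ) ^ i * f i * (∏ j ∈ Finset.range i, g j) / ∏ k ∈ Finset.range (i + 1), d k| := by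
  have hP : 0 < ∏ j ∈ Finset.range i, g j := Finset.prod_pos fun j _ => hg j
  have hD : 0 < ∏ k ∈ Finset.range (i + 1), d k := Finset.prod_pos fun k _ => hd k
  rw [Finset.prod_range_succ g, Finset.prod_range_succ d (i + 1)]
  simp only [abs_div, abs_mul, abs_pow, abs_neg, abs_one, one_pow, one_mul, abs_of_pos hP,
    abs_of_pos hD, abs_of_pos (hf _), abs_of_pos (hg _), abs_of_pos (hd _)]
  have hd' := hd (i + 1)
  rw [div_lt_div_iff₀ (by positivity) hD]
  nlinarith [mul_lt_mul_of_pos_right h (mul_pos hP hD)]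

/-- For `ℓ ≥ 1`, `q ≥ 2`, the sequences `|G_ℓ(i)|` and `|H_ℓ(i)|` are strictly
decreasing in `i`. -/
theorem GH_abs_strictAnti (q ℓ : ℕ) (hq : 2 ≤ q) (hℓ : 1 ≤ ℓ) :
    ∀ i : ℕ, 1 ≤ i →
      |Gterm q ℓ i| < |Gterm q ℓ (i - 1)| ∧ |Hterm q ℓ i| < |Hterm q ℓ (i - 1)| := by
  have hq' : (2 : ℝ) ≤ q := by exact_mod_cast hq
  have hq0 : (0 : ℝ) < q := by linarith
  let y : ℕ → ℝ := fun i => (q : ℝ) ^ (-(2 : ℤ) ^ (i + 1))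
  have hy0 : ∀ i, 0 < y i := fun i => zpow_pos hq0 _
  have hysq : ∀ i, y (i + 1) = y i ^ 2 := fun i => by
    simp only [y]
    rw [← zpow_natCast, ← zpow_mul]
    congr 1
    push_cast
    ring
  have hy : ∀ i, (q : ℝ) ^ 2 * y i ≤ 1 := fun i => by
    simp only [y]
    rw [← zpow_natCast, ← zpow_add₀ hq0.ne']
    refine zpow_le_one_of_nonpos₀ (by linarith) ?_
    have : (1 : ℤ) ≤ 2 ^ i := one_le_pow₀ (by norm_num)
    push_cast
    rw [pow_succ]
    linarith
  have hd : ∀ i : ℕ, (q : ℝ) ^ ((1 : ℤ) - 2 ^ (i + 1)) = q * y i := fun i => by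
    simp only [y]
    rw [sub_eq_add_neg, zpow_add₀ hq0.ne', zpow_one]
  have hd0 : ∀ i : ℕ, 0 < 1 - (q : ℝ) ^ ((1 : ℤ) - 2 ^ (i + 1)) := fun i => by
    rw [hd]
    linarith [(pow_le_half_mul hq hℓ (hy0 i) (hy i)).2.2.2]
  intro i hi
  obtain ⟨i, rfl⟩ := Nat.exists_eq_add_of_le' hi
  rw [Nat.add_sub_cancel]
  constructor
  · refine abs_alternating_term_succ_lt (f := fun i => rPoly q ℓ (y i))
      (g := fun i => sPoly q ℓ (y i)) (d := fun i : ℕ => 1 - (q : ℝ) ^ ((1 : ℤ) - 2 ^ (i + 1)))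
      (fun j => rPoly_pos hq hℓ (hy0 j) (hy j)) (fun j => sPoly_pos hq hℓ (hy0 j) (hy j)) hd0 ?_
    simp only [hd, hysq]
    exact rPoly_sq_mul_sPoly_lt hq hℓ (hy0 i) (hy i)
  · refine abs_alternating_term_succ_lt (f := fun i => uPoly q ℓ (y i))
      (g := fun i => vPoly q ℓ (y i)) (d := fun i : ℕ => 1 - (q : ℝ) ^ ((1 : ℤ) - 2 ^ (i + 1)))
      (fun j => uPoly_pos hq hℓ (hy0 j) (hy j)) (fun j => vPoly_pos hq hℓ (hy0 j) (hy j)) hd0 ?_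
    simp only [hd, hysq]
    exact uPoly_sq_mul_vPoly_lt hq hℓ (hy0 i) (hy i)
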